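/- arXiv:physics/0311077 — 3 statements merged into one kernel-verified Lean document; each statement's English description precedes it below -/
import Mathlib

section
/- Let L be a positive integer and let f : ℤ × ℕ → ℝ satisfy: f(m,n) = 0 for all |m| > L; f(m,n) = 0 for every n ≥ 1 and m ∉ {−L, L}; and f is non-propagating. If there exist m₀ ∈ ℤ, real numbers A ≠ 0, ω and φ such that y_f(m₀, n) = A·cos(ω·n + φ) for all n ∈ ℕ, then 2Lω/π is an integer; equivalently, ωL = jπ/2 for some j ∈ ℤ (the discrete analogue, with unit wave speed so that the wavenumber k equals ω, of the non-propagation condition kL = nπ/2). -/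
/-- Displacement of the discrete lattice string with zero initial field under
forcing `f`: each forced displacement splits evenly into a right-traveling and a
left-traveling component. -/
noncomputable def latticeY (f : ℤ × ℕ → ℝ) (m : ℤ) (n : ℕ) : ℝ :=
  (1 / 2) * ∑ k ∈ Finset.range (n + 1),
    (f (m - ((n - k : ℕ) : ℤ), k) + f (m + ((n - k : ℕ) : ℤ), k))

/-- `f` is non-propagating for the region `|m| ≤ L`. -/
def NonProp (L : ℕ) (f : ℤ × ℕ → ℝ) : Prop :=
  ∀ m : ℤ, ∀ n : ℕ, (L : ℤ) < |m| → latticeY f m n = 0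

/-- Twice the right-traveling component of the displacement generated by `f`. -/
def rightSum (f : ℤ × ℕ → ℝ) (m : ℤ) (n : ℕ) : ℝ :=
  ∑ k ∈ Finset.range (n + 1), f (m - ((n - k : ℕ) : ℤ), k)

/-- The forcing reflected about the origin. -/
def reflectForcing (f : ℤ × ℕ → ℝ) (p : ℤ × ℕ) : ℝ := f (-p.1, p.2)

theorem latticeY_eq_rightSum (f : ℤ × ℕ → ℝ) (m : ℤ) (n : ℕ) :
    latticeY f m n = (1 / 2) * (rightSum f m n + rightSum (reflectForcing f) (-m) n) := by
  have hneg (a : ℤ) : -(-m - a) = m + a := by ring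
  simp only [latticeY, rightSum, reflectForcing, Finset.sum_add_distrib, hneg]

theorem reflectForcing_reflectForcing (f : ℤ × ℕ → ℝ) :
    reflectForcing (reflectForcing f) = f := by
  funext p
  simp [reflectForcing]

theorem latticeY_reflectForcing (f : ℤ × ℕ → ℝ) (m : ℤ) (n : ℕ) :
    latticeY (reflectForcing f) m n = latticeY f (-m) n := by
  rw [latticeY_eq_rightSum, latticeY_eq_rightSum, reflectForcing_reflectForcing, neg_neg, add_comm]

theorem NonProp.reflectForcing {L : ℕ} {f : ℤ × ℕ → ℝ} (h : NonProp L f) :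
    NonProp L (reflectForcing f) := fun m n hm => by
  rw [latticeY_reflectForcing]
  exact h _ _ (by rwa [abs_neg])

theorem rightSum_succ (f : ℤ × ℕ → ℝ) (m : ℤ) (n : ℕ) :
    rightSum f m (n + 1) = rightSum f (m - 1) n + f (m, n + 1) := by
  rw [rightSum, Finset.sum_range_succ, rightSum]
  congr 1
  · refine Finset.sum_congr rfl fun k hk => ?_
    have hk' : k < n + 1 := Finset.mem_range.mp hk
    congr 2
    omega
  · simp

section Trapped

variable {L : ℕ} {f : ℤ × ℕ → ℝ}

theorem rightSum_eq_zero_of_lt (hsupp : ∀ m : ℤ, ∀ n : ℕ, (L : ℤ) < |m| → f (m, n) = 0)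
    {m : ℤ} (hm : m < -(L : ℤ)) (n : ℕ) : rightSum f m n = 0 :=
  Finset.sum_eq_zero fun k _ => hsupp _ _ (by rw [lt_abs]; omega)

theorem reflectForcing_eq_zero_of_lt (hsupp : ∀ m : ℤ, ∀ n : ℕ, (L : ℤ) < |m| → f (m, n) = 0)
    (m : ℤ) (n : ℕ) (hm : (L : ℤ) < |m|) : reflectForcing f (m, n) = 0 :=
  hsupp _ _ (by rwa [abs_neg])

theorem reflectForcing_eq_zero_of_ne
    (hbd : ∀ n : ℕ, 1 ≤ n → ∀ m : ℤ, m ≠ -(L : ℤ) → m ≠ (L : ℤ) → f (m, n) = 0)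
    (n : ℕ) (hn : 1 ≤ n) (m : ℤ) (hm : m ≠ -(L : ℤ)) (hm' : m ≠ (L : ℤ)) :
    reflectForcing f (m, n) = 0 :=
  hbd n hn _ (by dsimp only; omega) (by dsimp only; omega)

theorem rightSum_left_end (hsupp : ∀ m : ℤ, ∀ n : ℕ, (L : ℤ) < |m| → f (m, n) = 0) (n : ℕ) :
    rightSum f (-L) n = f (-L, n) := by
  cases n with
  | zero => simp [rightSum]
  | succ n => rw [rightSum_succ, rightSum_eq_zero_of_lt hsupp (by omega), zero_add]

theorem rightSum_right_end (hsupp : ∀ m : ℤ, ∀ n : ℕ, (L : ℤ) < |m| → f (m, n) = 0)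
    (hnp : NonProp L f) (n : ℕ) : rightSum f L n = 0 := by
  have hout : (L : ℤ) < |(L : ℤ) + 1| := by rw [lt_abs]; omega
  have hleft : rightSum (reflectForcing f) (-((L : ℤ) + 1)) (n + 1) = 0 :=
    rightSum_eq_zero_of_lt (reflectForcing_eq_zero_of_lt hsupp) (by omega) _
  have h := hnp (L + 1) (n + 1) hout
  rw [latticeY_eq_rightSum, hleft, rightSum_succ, hsupp _ _ hout, add_sub_cancel_right] at h
  linarith

theorem rightSum_interior (hsupp : ∀ m : ℤ, ∀ n : ℕ, (L : ℤ) < |m| → f (m, n) = 0)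
    (hbd : ∀ n : ℕ, 1 ≤ n → ∀ m : ℤ, m ≠ -(L : ℤ) → m ≠ (L : ℤ) → f (m, n) = 0)
    (j n : ℕ) (hj : j < 2 * L) : rightSum f (-L + j) (n + j) = f (-L, n) := by
  induction j with
  | zero => simpa using rightSum_left_end hsupp n
  | succ j ih =>
    rw [← add_assoc, rightSum_succ, hbd _ (by omega) _ (by omega) (by omega), add_zero,
      ← ih (by omega)]
    congr 1
    push_cast
    ring

theorem forcing_right_end (hL : 1 ≤ L)
    (hsupp : ∀ m : ℤ, ∀ n : ℕ, (L : ℤ) < |m| → f (m, n) = 0)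
    (hbd : ∀ n : ℕ, 1 ≤ n → ∀ m : ℤ, m ≠ -(L : ℤ) → m ≠ (L : ℤ) → f (m, n) = 0)
    (hnp : NonProp L f) (n : ℕ) : f (L, n + 2 * L) = -f (-L, n) := by
  have h := rightSum_right_end hsupp hnp (n + (2 * L - 1) + 1)
  have hpos : (L : ℤ) - 1 = -L + (2 * L - 1 : ℕ) := by omega
  rw [rightSum_succ, hpos, rightSum_interior hsupp hbd _ _ (by omega)] at h
  rw [show n + 2 * L = n + (2 * L - 1) + 1 by omega]
  linarith

theorem rightSum_periodic (hL : 1 ≤ L)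
    (hsupp : ∀ m : ℤ, ∀ n : ℕ, (L : ℤ) < |m| → f (m, n) = 0)
    (hbd : ∀ n : ℕ, 1 ≤ n → ∀ m : ℤ, m ≠ -(L : ℤ) → m ≠ (L : ℤ) → f (m, n) = 0)
    (hnp : NonProp L f) {m : ℤ} (hm : |m| ≤ L) {n : ℕ} (hn : 2 * L ≤ n) :
    rightSum f m (n + 4 * L) = rightSum f m n := by
  obtain ⟨hm₁, hm₂⟩ := abs_le.mp hm
  rcases hm₂.eq_or_lt with rfl | hlt
  · rw [rightSum_right_end hsupp hnp, rightSum_right_end hsupp hnp]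
  · obtain ⟨j, hj⟩ := Int.eq_ofNat_of_zero_le (show 0 ≤ m + L by omega)
    obtain ⟨p, rfl⟩ := Nat.exists_eq_add_of_le' (show j ≤ n by omega)
    obtain rfl : m = -L + j := by omega
    rw [add_right_comm, rightSum_interior hsupp hbd _ _ (by omega),
      rightSum_interior hsupp hbd _ _ (by omega)]
    have h₁ := forcing_right_end hL hsupp hbd hnp p
    have h₂ := forcing_right_end (f := reflectForcing f) hL
      (reflectForcing_eq_zero_of_lt hsupp)
      (reflectForcing_eq_zero_of_ne hbd)
      hnp.reflectForcing (p + 2 * L)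
    simp only [reflectForcing, neg_neg] at h₂
    rw [show p + 4 * L = p + 2 * L + 2 * L by ring, h₂, h₁, neg_neg]

theorem latticeY_periodic (hL : 1 ≤ L)
    (hsupp : ∀ m : ℤ, ∀ n : ℕ, (L : ℤ) < |m| → f (m, n) = 0)
    (hbd : ∀ n : ℕ, 1 ≤ n → ∀ m : ℤ, m ≠ -(L : ℤ) → m ≠ (L : ℤ) → f (m, n) = 0)
    (hnp : NonProp L f) (m : ℤ) {n : ℕ} (hn : 2 * L ≤ n) :
    latticeY f m (n + 4 * L) = latticeY f m n := by
  rcases lt_or_ge (L : ℤ) |m| with hm | hm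
  · rw [hnp _ _ hm, hnp _ _ hm]
  · rw [latticeY_eq_rightSum, latticeY_eq_rightSum, rightSum_periodic hL hsupp hbd hnp hm hn,
      rightSum_periodic (f := reflectForcing f) hL
        (reflectForcing_eq_zero_of_lt hsupp)
        (reflectForcing_eq_zero_of_ne hbd)
        hnp.reflectForcing (by rwa [abs_neg]) hn]

end Trapped

theorem sin_sub_eq_zero_of_sin_eq_zero {x y : ℝ} (hx : Real.sin x = 0) (hy : Real.sin y = 0) :
    Real.sin (x - y) = 0 := by
  rw [Real.sin_sub, hx, hy]
  ring

theorem exists_mul_pi_of_cos_periodic {ω φ : ℝ} {N L : ℕ}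
    (h : ∀ n : ℕ, N ≤ n → Real.cos (ω * (n + 4 * L : ℕ) + φ) = Real.cos (ω * n + φ)) :
    ∃ j : ℤ, ω * L = j * Real.pi / 2 := by
  have hprod : ∀ n : ℕ, N ≤ n →
      Real.sin (ω * n + φ + 2 * L * ω) = 0 ∨ Real.sin (2 * L * ω) = 0 := by
    intro n hn
    have hcos := sub_eq_zero.mpr (h n hn)
    rw [Real.cos_sub_cos] at hcos
    push_cast at hcos
    rw [show (ω * (n + 4 * L) + φ + (ω * n + φ)) / 2 = ω * n + φ + 2 * L * ω by ring,
      show (ω * (n + 4 * L) + φ - (ω * n + φ)) / 2 = 2 * L * ω by ring] at hcos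
    simpa using hcos
  by_cases hs : Real.sin (2 * L * ω) = 0
  · obtain ⟨j, hj⟩ := Real.sin_eq_zero_iff.mp hs
    exact ⟨j, by linarith⟩
  · have hsin := sin_sub_eq_zero_of_sin_eq_zero
      ((hprod (N + 1) (by omega)).resolve_right hs) ((hprod N le_rfl).resolve_right hs)
    obtain ⟨j, hj⟩ := Real.sin_eq_zero_iff.mp hsin
    refine ⟨2 * j * L, ?_⟩
    push_cast at hj ⊢
    linear_combination -(L : ℝ) * hj

/-- if a trapped field oscillates time-harmonically at some site,
then `ωL = jπ/2` for some integer `j` (discrete analogue, with unit wave speed,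
of the non-propagation condition `kL = nπ/2`). -/
theorem trapped_harmonic_oscillation_wavenumber_condition
    (L : ℕ) (hL : 1 ≤ L) (f : ℤ × ℕ → ℝ)
    (hsupp : ∀ m : ℤ, ∀ n : ℕ, (L : ℤ) < |m| → f (m, n) = 0)
    (hbd : ∀ n : ℕ, 1 ≤ n → ∀ m : ℤ, m ≠ -(L : ℤ) → m ≠ (L : ℤ) → f (m, n) = 0)
    (hnp : NonProp L f)
    (m₀ : ℤ) (A ω φ : ℝ) (hA : A ≠ 0)
    (hosc : ∀ n : ℕ, latticeY f m₀ n = A * Real.cos (ω * n + φ)) :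
    ∃ j : ℤ, ω * L = j * Real.pi / 2 := by
  refine exists_mul_pi_of_cos_periodic (N := 2 * L) (φ := φ) fun n hn => ?_
  have h := latticeY_periodic hL hsupp hbd hnp m₀ hn
  rw [hosc, hosc] at h
  exact mul_left_cancel₀ hA h
end

section
/- Let L ≥ 1, p, q, N be integers with |p| < L, |q| < L, N ≥ 1, let a, b be nonzero reals, and let f : ℤ × ℕ → ℝ satisfy: f(p,0) = a and f(m,0) = 0 for m ≠ p; f(q,N) = b; for every n ≥ 1, f(m,n) = 0 unless m ∈ {−L, L} or (m,n) = (q,N); f(m,n) = 0 for all m whenever n > N; f is non-propagating; and y_f(m,n) = 0 for all m ∈ ℤ and all n > N (the string is at rest after the excitation ends). Then there exists an integer μ ≥ 1 with N = 2μL, and moreover q = (−1)^μ·p and b = (−1)^{μ+1}·a. (The duration of any single-impulse finite non-propagating excitation is a multiple of 2L.) -/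
open Finset

/-- Summing a function supported on nonnegative integers against the indicator of one point. -/
lemma sum_range_ite_cast_eq (G : ℤ → ℝ) (hG : ∀ z < 0, G z = 0) (n : ℕ) (z : ℤ) (hz : z < n) :
    ∑ k ∈ range n, (if (k : ℤ) = z then G k else 0) = G z := by
  rcases lt_or_ge z 0 with h | h
  · rw [hG z h]
    exact sum_eq_zero fun k _ => if_neg (by omega)
  · lift z to ℕ using h
    rw [sum_eq_single z]
    · simp
    · exact fun k _ hk => if_neg (by omega)
    · intro h
      simp only [mem_range] at h
      omega

lemma latticeY_reflect (f : ℤ × ℕ → ℝ) (m : ℤ) (n : ℕ) :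
    latticeY (fun x => f (-x.1, x.2)) m n = latticeY f (-m) n := by
  unfold latticeY
  congr 1
  refine sum_congr rfl fun k _ => ?_
  rw [add_comm]
  congr 3 <;> ring_nf

lemma NonProp.reflect {L : ℕ} {f : ℤ × ℕ → ℝ} (h : NonProp L f) :
    NonProp L (fun x => f (-x.1, x.2)) := by
  intro m n hm
  rw [latticeY_reflect]
  exact h _ _ (by rwa [abs_neg])

/-- The right-traveling signal leaving the region at the boundary point `L` vanishes. -/
lemma NonProp.outgoing_eq_zero {L : ℕ} {f : ℤ × ℕ → ℝ} {p q : ℤ}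
    (hp : |p| < (L : ℤ)) (hq : |q| < (L : ℤ)) {A B P Q : ℤ → ℝ}
    (hA : ∀ z < 0, A z = 0) (hB : ∀ z < 0, B z = 0)
    (hP : ∀ z < 0, P z = 0) (hQ : ∀ z < 0, Q z = 0)
    (hf : ∀ x : ℤ, ∀ k : ℕ, f (x, k) = (if x = L then A k else 0) + (if x = -L then B k else 0)
      + (if x = p then P k else 0) + (if x = q then Q k else 0))
    (h : NonProp L f) (t : ℤ) :
    A t + B (t - 2 * L) + P (t + p - L) + Q (t + q - L) = 0 := by
  rw [abs_lt] at hp hq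
  rcases lt_or_ge t 0 with ht | ht
  · rw [hA _ ht, hB _ (by omega), hP _ (by omega), hQ _ (by omega)]
    simp
  lift t to ℕ using ht
  have key := h (L + 1) (t + 1) (by rw [abs_of_pos] <;> omega)
  unfold latticeY at key
  rw [mul_eq_zero, or_iff_right (by norm_num)] at key
  rw [← key, ← sum_range_ite_cast_eq A hA (t + 1 + 1) t (by push_cast; omega),
    ← sum_range_ite_cast_eq B hB (t + 1 + 1) (t - 2 * L) (by push_cast; omega),
    ← sum_range_ite_cast_eq P hP (t + 1 + 1) (t + p - L) (by push_cast; omega),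
    ← sum_range_ite_cast_eq Q hQ (t + 1 + 1) (t + q - L) (by push_cast; omega),
    ← sum_add_distrib, ← sum_add_distrib, ← sum_add_distrib]
  refine sum_congr rfl fun k hk => ?_
  rw [mem_range] at hk
  have hright : f ((L : ℤ) + 1 + ((t + 1 - k : ℕ) : ℤ), k) = 0 := by
    rw [hf, if_neg (by omega), if_neg (by omega), if_neg (by omega), if_neg (by omega)]
    simp
  rw [hright, hf, add_zero]
  congr 1
  · congr 1
    · congr 1 <;> exact if_congr (by omega) rfl rfl
    · exact if_congr (by omega) rfl rfl
  · exact if_congr (by omega) rfl rfl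

lemma sum_range_ite_progression (D r e : ℤ) (hr : 0 ≤ r) (hrD : r < D) (he : 0 ≤ e) (M : ℕ)
    (hM : e < M) (c : ℝ) :
    ∑ j ∈ range M, (if r + D * j = e then c else 0) = if e % D = r then c else 0 := by
  have hD : 0 < D := by omega
  have hdiv : 0 ≤ e / D := Int.ediv_nonneg he hD.le
  have hle : e / D ≤ e := Int.ediv_le_self _ he
  have hiff : ∀ j : ℤ, r + D * j = e ↔ j = e / D ∧ e % D = r := by
    intro j
    constructor
    · rintro rfl
      rw [Int.add_mul_ediv_left _ _ hD.ne', Int.add_mul_emod_self_left,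
        Int.ediv_eq_zero_of_lt hr hrD, Int.emod_eq_of_lt hr hrD]
      simp
    · rintro ⟨rfl, rfl⟩
      exact Int.emod_add_mul_ediv e D
  simp only [hiff]
  lift e / D to ℕ using hdiv with w
  by_cases hres : e % D = r
  · simp only [hres, and_true, Nat.cast_inj, if_true]
    rw [sum_ite_eq', if_pos (by rw [mem_range]; omega)]
  · simp [hres]

/-- A finitely supported solution of `F t - F (t - D) = s t` forces the sum of `s` over each
residue class modulo `D` to vanish. -/
lemma sum_progression_eq_zero {F s : ℤ → ℝ} {D r : ℤ} {N : ℕ} (hr : 0 ≤ r) (hrD : r < D)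
    (hneg : ∀ z < 0, F z = 0) (hlarge : ∀ z : ℤ, N < z → F z = 0)
    (hs : ∀ t, F t - F (t - D) = s t) {M : ℕ} (hM : N + 1 < M) :
    ∑ j ∈ range M, s (r + D * j) = 0 := by
  have hsum := sum_range_sub (fun j : ℕ => F (r + D * j - D)) M
  have hM' : (N : ℤ) < r + D * M - D := by
    have : (N : ℤ) + 1 < M := by exact_mod_cast hM
    nlinarith
  have h0 : F (r + D * (0 : ℕ) - D) = 0 := hneg _ (by push_cast; omega)
  simp only [hlarge _ hM', h0, sub_zero] at hsum
  rw [← hsum]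
  refine sum_congr rfl fun j _ => ?_
  rw [← hs]
  congr 2
  push_cast
  ring

lemma exists_duration {L : ℕ} {p q : ℤ} (hp : |p| < (L : ℤ)) (hq : |q| < (L : ℤ))
    {N : ℕ} (hN : 1 ≤ N) {a b : ℝ} (ha : a ≠ 0)
    (h : ∀ r : ℤ, 0 ≤ r → r < 4 * L →
      (if (N + L - q) % (4 * (L : ℤ)) = r then b else 0)
        + (if (L - p) % (4 * (L : ℤ)) = r then a else 0)
      = (if (N + 3 * L + q) % (4 * (L : ℤ)) = r then b else 0)
        + (if (3 * L + p) % (4 * (L : ℤ)) = r then a else 0)) :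
    ∃ μ : ℕ, 1 ≤ μ ∧ N = 2 * μ * L ∧
      q = (-1 : ℤ) ^ μ * p ∧ b = (-1 : ℝ) ^ (μ + 1) * a := by
  rw [abs_lt] at hp hq
  have h₁ := h (L - p) (by omega) (by omega)
  have h₂ := h (3 * L + p) (by omega) (by omega)
  rw [Int.emod_eq_of_lt (a := L - p) (by omega) (by omega),
    Int.emod_eq_of_lt (a := 3 * L + p) (by omega) (by omega), if_pos rfl,
    if_neg (c := 3 * (L : ℤ) + p = L - p) (by omega)] at h₁
  rw [Int.emod_eq_of_lt (a := L - p) (by omega) (by omega),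
    Int.emod_eq_of_lt (a := 3 * L + p) (by omega) (by omega), if_pos rfl,
    if_neg (c := (L : ℤ) - p = 3 * L + p) (by omega)] at h₂
  have hx := Int.emod_add_mul_ediv (N + L - q) (4 * (L : ℤ))
  have hy := Int.emod_add_mul_ediv (N + 3 * L + q) (4 * (L : ℤ))
  set x := (N + L - q) % (4 * (L : ℤ))
  set y := (N + 3 * L + q) % (4 * (L : ℤ))
  set u := (N + L - q) / (4 * (L : ℤ))
  set v := (N + 3 * L + q) / (4 * (L : ℤ))
  have hL : (0 : ℤ) < L := by omega
  have hN' : (1 : ℤ) ≤ N := by exact_mod_cast hN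
  by_cases hx₁ : x = L - p
  · have hy₁ : y ≠ L - p := by
      intro hy₁
      rw [if_pos hx₁, if_pos hy₁] at h₁
      exact ha (by linarith)
    have hx₂ : x ≠ 3 * L + p := by omega
    rw [if_pos hx₁, if_neg hy₁] at h₁
    have hy₂ : y = 3 * L + p := by
      by_contra hy₂
      rw [if_neg hx₂, if_neg hy₂] at h₂
      exact ha (by linarith)
    have huv : u = v := by
      have hlt : u < v + 1 := by nlinarith
      have hgt : v < u + 1 := by nlinarith
      omega
    rw [← huv] at hy
    have hqp : q = p := by linarith
    have hNu : (N : ℤ) = 4 * L * u := by linarith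
    have hu : 0 < u := by by_contra hu; nlinarith
    lift u to ℕ using hu.le with w
    refine ⟨2 * w, by omega, ?_, ?_, ?_⟩
    · zify; rw [hNu]; ring
    · rw [pow_mul]; simp [hqp]
    · rw [pow_succ, pow_mul]; norm_num; linarith
  · rw [if_neg hx₁] at h₁
    have hy₁ : y = L - p := by
      by_contra hy₁
      rw [if_neg hy₁] at h₁
      exact ha (by linarith)
    rw [if_pos hy₁] at h₁
    have hy₂ : y ≠ 3 * L + p := by omega
    have hx₂ : x = 3 * L + p := by
      by_contra hx₂
      rw [if_neg hx₂, if_neg hy₂] at h₂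
      exact ha (by linarith)
    have huv : v = u + 1 := by
      have hlt : v < u + 2 := by nlinarith
      have hgt : u < v := by nlinarith
      omega
    rw [huv] at hy
    have hqp : q = -p := by linarith
    have hNu : (N : ℤ) = 4 * L * u + 2 * L := by linarith
    have hu : 0 ≤ u := by by_contra hu; nlinarith
    lift u to ℕ using hu with w
    refine ⟨2 * w + 1, by omega, ?_, ?_, ?_⟩
    · zify; rw [hNu]; ring
    · rw [pow_succ, pow_mul]; simp [hqp]
    · rw [pow_succ, pow_succ, pow_mul]; norm_num; linarith


/-- the duration of any single-impulse finite non-propagating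
excitation is a multiple of `2L`, and the annihilating impulse must be the
sign-appropriate mirror copy of the initial one. -/
theorem finite_trap_duration_is_multiple_of_2L
    (L : ℕ) (hL : 1 ≤ L) (p q : ℤ) (hp : |p| < (L : ℤ)) (hq : |q| < (L : ℤ))
    (N : ℕ) (hN : 1 ≤ N) (a b : ℝ) (ha : a ≠ 0) (hb : b ≠ 0)
    (f : ℤ × ℕ → ℝ)
    (hf0 : f (p, 0) = a)
    (hf0' : ∀ m : ℤ, m ≠ p → f (m, 0) = 0)
    (hfq : f (q, N) = b)
    (hbd : ∀ n : ℕ, 1 ≤ n → ∀ m : ℤ,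
      m ≠ -(L : ℤ) → m ≠ (L : ℤ) → (m, n) ≠ (q, N) → f (m, n) = 0)
    (hoff : ∀ n : ℕ, N < n → ∀ m : ℤ, f (m, n) = 0)
    (hnp : NonProp L f)
    (hrest : ∀ m : ℤ, ∀ n : ℕ, N < n → latticeY f m n = 0) :
    ∃ μ : ℕ, 1 ≤ μ ∧ N = 2 * μ * L ∧
      q = (-1 : ℤ) ^ μ * p ∧ b = (-1 : ℝ) ^ (μ + 1) * a := by
  have hp' := abs_lt.mp hp
  have hq' := abs_lt.mp hq
  set column : ℤ → ℤ → ℝ := fun x z => if 0 ≤ z then f (x, z.toNat) else 0 with hcolumn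
  have column_neg : ∀ x, ∀ z < 0, column x z = 0 := fun x z hz => if_neg (by omega)
  have column_nat : ∀ x : ℤ, ∀ k : ℕ, column x k = f (x, k) := fun x k => by simp [hcolumn]
  have column_large : ∀ x z : ℤ, N < z → column x z = 0 := by
    intro x z hz
    lift z to ℕ using by omega
    rw [column_nat]
    exact hoff z (by omega) x
  set P : ℤ → ℝ := fun z => if z = 0 then a else 0 with hPdef
  set Q : ℤ → ℝ := fun z => if z = N then b else 0 with hQdef
  have hP : ∀ z < 0, P z = 0 := fun z hz => if_neg (by omega)
  have hQ : ∀ z < 0, Q z = 0 := fun z hz => if_neg (by omega)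
  have hcol : ∀ x : ℤ, ∀ k : ℕ, f (x, k) = (if x = L then column L k else 0)
      + (if x = -L then column (-L) k else 0)
      + (if x = p then P k else 0) + (if x = q then Q k else 0) := by
    intro x k
    simp only [column_nat]
    by_cases hx₁ : x = L
    · rw [if_pos hx₁, if_neg (by omega), if_neg (by omega), if_neg (by omega), hx₁]
      simp
    by_cases hx₂ : x = -L
    · rw [if_neg hx₁, if_pos hx₂, if_neg (by omega), if_neg (by omega), hx₂]
      simp
    rw [if_neg hx₁, if_neg hx₂]
    rcases Nat.eq_zero_or_pos k with rfl | hk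
    · have hN0 : ¬ (0 : ℤ) = N := by omega
      by_cases hxp : x = p
      · simp [hPdef, hQdef, hxp, hf0, hN0]
      · simp [hQdef, hxp, hf0' x hxp, hN0]
    · have hk0 : k ≠ 0 := by omega
      by_cases hxk : (x, k) = (q, N)
      · obtain ⟨rfl, rfl⟩ := Prod.mk.inj hxk
        simp [hPdef, hQdef, hk0, hfq]
      · rw [hbd k hk x hx₂ hx₁ hxk]
        have : x = q → k ≠ N := fun h₁ h₂ => hxk (by rw [h₁, h₂])
        simp +contextual [hPdef, hQdef, hk0, this]
  have hright := hnp.outgoing_eq_zero hp hq (column_neg L) (column_neg (-L)) hP hQ hcol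
  have hleft := hnp.reflect.outgoing_eq_zero (p := -p) (q := -q) (by rwa [abs_neg])
    (by rwa [abs_neg]) (column_neg (-L)) (column_neg L) hP hQ (by
      intro x k
      simp only [hcol (-x) k, neg_eq_iff_eq_neg, neg_neg]
      ring)
  refine exists_duration hp hq hN ha fun r hr hrD => ?_
  have hsum := sum_progression_eq_zero (M := N + 4 * L + 2) hr hrD (column_neg L) (column_large L)
    (s := fun t => (if t = 3 * L + p then a else 0) + (if t = N + 3 * L + q then b else 0)
      - (if t = L - p then a else 0) - (if t = N + L - q then b else 0)) (by
      intro t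
      have h₁ := hright t
      have h₂ := hleft (t - 2 * L)
      rw [show t - 2 * (L : ℤ) - 2 * L = t - 4 * L by ring] at h₂
      have e₁ : P (t + p - L) = if t = L - p then a else 0 := if_congr (by omega) rfl rfl
      have e₂ : Q (t + q - L) = if t = N + L - q then b else 0 := if_congr (by omega) rfl rfl
      have e₃ : P (t - 2 * L + -p - L) = if t = 3 * L + p then a else 0 :=
        if_congr (by omega) rfl rfl
      have e₄ : Q (t - 2 * L + -q - L) = if t = N + 3 * L + q then b else 0 :=
        if_congr (by omega) rfl rfl
      rw [← e₁, ← e₂, ← e₃, ← e₄]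
      linarith) (by omega)
  simp only [sum_sub_distrib, sum_add_distrib] at hsum
  rw [sum_range_ite_progression _ _ _ hr hrD (by omega) _ (by push_cast; omega),
    sum_range_ite_progression _ _ _ hr hrD (by omega) _ (by push_cast; omega),
    sum_range_ite_progression _ _ _ hr hrD (by omega) _ (by push_cast; omega),
    sum_range_ite_progression _ _ _ hr hrD (by omega) _ (by push_cast; omega)] at hsum
  linarith
end

section
/- Let L ≥ 1 and p be integers with |p| < L, let a ≠ 0 be real, and let μ ≥ 1 be an integer. Then there exists a forcing f : ℤ × ℕ → ℝ and an integer q with |q| < L and a real b ≠ 0 such that: f(p,0) = a and f(m,0) = 0 for m ≠ p; f(q, 2μL) = b; for every n ≥ 1, f(m,n) = 0 unless m ∈ {−L, L} or (m,n) = (q, 2μL); f(m,n) = 0 for all m whenever n > 2μL; f is non-propagating; and y_f(m,n) = 0 for all m ∈ ℤ and all n ≥ 2μL. That is, single-impulse finite non-propagating excitations of duration 2μL exist for every μ ≥ 1. -/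
/-- The forcing with a single impulse of size `c` at the site `p` and time `t`. -/
noncomputable def impulse (p : ℤ) (t : ℕ) (c : ℝ) : ℤ × ℕ → ℝ :=
  fun x => if x = (p, t) then c else 0

/-- The forcing `g` delayed by `d` time steps. -/
noncomputable def delay (d : ℕ) (g : ℤ × ℕ → ℝ) : ℤ × ℕ → ℝ :=
  fun x => if d ≤ x.2 then g (x.1, x.2 - d) else 0

theorem delay_of_le {d n : ℕ} (h : d ≤ n) (g : ℤ × ℕ → ℝ) (m : ℤ) :
    delay d g (m, n) = g (m, n - d) :=
  if_pos h

theorem delay_of_lt {d n : ℕ} (h : n < d) (g : ℤ × ℕ → ℝ) (m : ℤ) : delay d g (m, n) = 0 :=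
  if_neg h.not_ge

theorem latticeY_add (f g : ℤ × ℕ → ℝ) (m : ℤ) (n : ℕ) :
    latticeY (f + g) m n = latticeY f m n + latticeY g m n := by
  simp only [latticeY, Pi.add_apply, Finset.sum_add_distrib]
  ring

theorem latticeY_impulse (p : ℤ) (t : ℕ) (c : ℝ) (m : ℤ) (n : ℕ) :
    latticeY (impulse p t c) m n =
      (1 / 2) * ((if t ≤ n ∧ m - n = p - t then c else 0) +
        (if t ≤ n ∧ m + n = p + t then c else 0)) := by
  have h : ∀ k ∈ Finset.range (n + 1),
      impulse p t c (m - ((n - k : ℕ) : ℤ), k) + impulse p t c (m + ((n - k : ℕ) : ℤ), k) =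
        if k = t then (if t ≤ n ∧ m - n = p - t then c else 0) +
          (if t ≤ n ∧ m + n = p + t then c else 0) else 0 := by
    intro k hk
    rw [Finset.mem_range] at hk
    simp only [impulse, Prod.mk.injEq]
    split_ifs <;> first | (exfalso; omega) | simp
  rw [latticeY, Finset.sum_congr rfl h, Finset.sum_ite_eq']
  split_ifs with h₁ <;> first | rfl | (simp only [Finset.mem_range] at h₁; exfalso; omega) | simp

theorem latticeY_delay (d : ℕ) (g : ℤ × ℕ → ℝ) (m : ℤ) (n : ℕ) :
    latticeY (delay d g) m n = if d ≤ n then latticeY g m (n - d) else 0 := by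
  split_ifs with h
  · obtain ⟨r, rfl⟩ := Nat.exists_eq_add_of_le h
    have hlt : ∀ k ∈ Finset.range d,
        delay d g (m - ((d + r - k : ℕ) : ℤ), k) + delay d g (m + ((d + r - k : ℕ) : ℤ), k) =
          0 := by
      intro k hk
      rw [Finset.mem_range] at hk
      rw [delay_of_lt hk, delay_of_lt hk, add_zero]
    rw [latticeY, latticeY, add_assoc d r 1, Finset.sum_range_add, Finset.sum_eq_zero hlt, zero_add,
      Nat.add_sub_cancel_left]
    simp [delay, Nat.add_sub_add_left]
  · rw [latticeY, Finset.sum_eq_zero, mul_zero]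
    intro k hk
    have hk' : ¬ d ≤ k := by
      rw [Finset.mem_range] at hk
      omega
    simp [delay, hk']

/-- An impulse at `p`, the two boundary impulses reflecting its halves back inwards, and the
impulse that annihilates the reflected halves when they meet at `-p`. -/
noncomputable def basicTrap (L : ℕ) (p : ℤ) (a : ℝ) : ℤ × ℕ → ℝ :=
  impulse p 0 a + impulse L (L - p).toNat (-a) + impulse (-L) (L + p).toNat (-a) +
    impulse (-p) (2 * L) a

theorem latticeY_basicTrap {L : ℕ} {p : ℤ} (hp : |p| < (L : ℤ)) (a : ℝ) {m : ℤ} {n : ℕ}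
    (h : (L : ℤ) < |m| ∨ 2 * L ≤ n) : latticeY (basicTrap L p a) m n = 0 := by
  obtain ⟨hp₁, hp₂⟩ := abs_lt.mp hp
  rw [lt_abs] at h
  obtain ⟨u, hu⟩ := Int.eq_ofNat_of_zero_le (show 0 ≤ (L : ℤ) - p by omega)
  obtain ⟨v, hv⟩ := Int.eq_ofNat_of_zero_le (show 0 ≤ (L : ℤ) + p by omega)
  simp only [basicTrap, latticeY_add, latticeY_impulse, hu, hv, Int.toNat_natCast]
  have right : (if 0 ≤ n ∧ m - n = p - (0 : ℕ) then a else 0) +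
      (if u ≤ n ∧ m - n = L - u then -a else 0) + (if v ≤ n ∧ m - n = -L - v then -a else 0) +
      (if 2 * L ≤ n ∧ m - n = -p - (2 * L : ℕ) then a else 0) = 0 := by
    split_ifs <;> first | (exfalso; omega) | ring
  have left : (if 0 ≤ n ∧ m + n = p + (0 : ℕ) then a else 0) +
      (if u ≤ n ∧ m + n = L + u then -a else 0) + (if v ≤ n ∧ m + n = -L + v then -a else 0) +
      (if 2 * L ≤ n ∧ m + n = -p + (2 * L : ℕ) then a else 0) = 0 := by
    split_ifs <;> first | (exfalso; omega) | ring
  linear_combination (1 / 2) * right + (1 / 2) * left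

theorem basicTrap_apply {L : ℕ} {p : ℤ} (hp : |p| < (L : ℤ)) (a : ℝ) {m : ℤ} {n : ℕ}
    (h₁ : n = 0 ∨ m ≠ -(L : ℤ) ∧ m ≠ L ∨ 2 * L ≤ n) :
    basicTrap L p a (m, n) =
      if (m, n) = (p, 0) ∨ (m, n) = (-p, 2 * L) then a else 0 := by
  obtain ⟨hp₁, hp₂⟩ := abs_lt.mp hp
  simp only [basicTrap, impulse, Pi.add_apply, Prod.mk.injEq]
  split_ifs <;> first | (exfalso; omega) | simp

/-- single-impulse finite non-propagating excitations of duration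
`2μL` exist for every `μ ≥ 1`. -/
theorem finite_trap_of_duration_2muL_exists
    (L : ℕ) (hL : 1 ≤ L) (p : ℤ) (hp : |p| < (L : ℤ)) (a : ℝ) (ha : a ≠ 0)
    (μ : ℕ) (hμ : 1 ≤ μ) :
    ∃ (f : ℤ × ℕ → ℝ) (q : ℤ) (b : ℝ),
      |q| < (L : ℤ) ∧ b ≠ 0 ∧
      f (p, 0) = a ∧
      (∀ m : ℤ, m ≠ p → f (m, 0) = 0) ∧
      f (q, 2 * μ * L) = b ∧
      (∀ n : ℕ, 1 ≤ n → ∀ m : ℤ,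
        m ≠ -(L : ℤ) → m ≠ (L : ℤ) → (m, n) ≠ (q, 2 * μ * L) → f (m, n) = 0) ∧
      (∀ n : ℕ, 2 * μ * L < n → ∀ m : ℤ, f (m, n) = 0) ∧
      NonProp L f ∧
      (∀ m : ℤ, ∀ n : ℕ, 2 * μ * L ≤ n → latticeY f m n = 0) := by
  obtain ⟨k, rfl⟩ := Nat.exists_eq_add_of_le' hμ
  clear hμ
  induction k generalizing p a with
  | zero =>
    refine ⟨basicTrap L p a, -p, a, by rwa [abs_neg], ha, ?_, ?_, ?_, ?_, ?_, ?_, ?_⟩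
    · rw [basicTrap_apply hp a (by omega)]
      simp
    · intro m hm
      rw [basicTrap_apply hp a (by omega), if_neg]
      simp only [Prod.mk.injEq]
      omega
    · rw [basicTrap_apply hp a (by omega)]
      simp
    · intro n hn m h₁ h₂ h₃
      rw [basicTrap_apply hp a (by omega), if_neg]
      simp only [ne_eq, Prod.mk.injEq] at h₃ ⊢
      omega
    · intro n hn m
      rw [basicTrap_apply hp a (by omega), if_neg]
      simp only [Prod.mk.injEq]
      omega
    · exact fun m n hm => latticeY_basicTrap hp a (Or.inl hm)
    · exact fun m n hn => latticeY_basicTrap hp a (Or.inr (by omega))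
  | succ k ih =>
    obtain ⟨g, q, b, hq, hb, hg₀, hg₀', hgq, hgn, hgt, hgp, hgy⟩ :=
      ih (-p) (by rwa [abs_neg]) (-a) (neg_ne_zero.mpr ha)
    have hdur : 2 * (k + 1 + 1) * L = 2 * (k + 1) * L + 2 * L := by ring
    have hpos : 1 ≤ 2 * (k + 1) * L := Nat.mul_pos (by omega) hL
    rw [hdur]
    generalize 2 * (k + 1) * L = T at *
    refine ⟨basicTrap L p a + delay (2 * L) g, q, b, hq, hb, ?_, ?_, ?_, ?_, ?_, ?_, ?_⟩
    · rw [Pi.add_apply, basicTrap_apply hp a (by omega), delay_of_lt (by omega)]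
      simp
    · intro m hm
      rw [Pi.add_apply, basicTrap_apply hp a (by omega), delay_of_lt (by omega),
        if_neg, add_zero]
      simp only [Prod.mk.injEq]
      omega
    · rw [Pi.add_apply, basicTrap_apply hp a (by omega), delay_of_le (by omega),
        if_neg]
      · simpa using hgq
      · simp only [Prod.mk.injEq]
        omega
    · intro n hn m h₁ h₂ h₃
      rw [Pi.add_apply, basicTrap_apply hp a (by omega)]
      simp only [ne_eq, Prod.mk.injEq] at h₃ ⊢
      rcases lt_trichotomy n (2 * L) with h | rfl | h
      · rw [if_neg (by omega), delay_of_lt h, add_zero]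
      · rw [delay_of_le le_rfl, Nat.sub_self]
        by_cases hm : m = -p
        · rw [if_pos (by omega), hm, hg₀, add_neg_cancel]
        · rw [if_neg (by omega), hg₀' m hm, add_zero]
      · rw [if_neg (by omega), delay_of_le h.le, zero_add]
        refine hgn _ (by omega) m h₁ h₂ ?_
        simp only [ne_eq, Prod.mk.injEq]
        omega
    · intro n hn m
      rw [Pi.add_apply, basicTrap_apply hp a (by omega), delay_of_le (by omega),
        if_neg, zero_add]
      · exact hgt _ (by omega) m
      · simp only [Prod.mk.injEq]
        omega
    · intro m n hm
      rw [latticeY_add, latticeY_basicTrap hp a (Or.inl hm), latticeY_delay, hgp m _ hm, ite_self,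
        add_zero]
    · intro m n hn
      rw [latticeY_add, latticeY_basicTrap hp a (Or.inr (by omega)), latticeY_delay,
        hgy m _ (by omega), ite_self, add_zero]
end
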